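/- For every natural number n and every real number z, (e^z + 1)·∫_{0}^{∞} ((ln t)ⁿ − zⁿ)/((1 + t)·(t − e^z)) dt = π^{n+1}·C_n(z/π), where the integral is taken over the open interval (0, ∞) (the integrand has a removable singularity at t = e^z since its numerator vanishes there) and C_n(z/π) denotes evaluation of C_n at the complex number z/π. -/

import Mathlib

open Polynomial Finset

/-- The pair of polynomial sequences (Aₙ, Cₙ) from the paper:
A₀ = X, C₀ = 0, and
A_{n+1} = ((n+1)/(n+2))·(X·Aₙ + ∑_{k=0}^{n} λₙᵏ·A_k),
C_{n+1} = ((n+1)/(n+2))·((X²+1)·Xⁿ + ∑_{k=0}^{n} λₙᵏ·C_k),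
where λₙᵏ is the coefficient of Xᵏ in Cₙ. -/
noncomputable def AC : ℕ → Polynomial ℂ × Polynomial ℂ
  | 0 => (Polynomial.X, 0)
  | (n+1) =>
    (((n+1 : ℂ)/(n+2)) • (Polynomial.X * (AC n).1 +
        ∑ k ∈ (Finset.range (n+1)).attach, ((AC n).2.coeff k) • (AC k).1),
     ((n+1 : ℂ)/(n+2)) • ((Polynomial.X^2 + 1) * Polynomial.X^n +
        ∑ k ∈ (Finset.range (n+1)).attach, ((AC n).2.coeff k) • (AC k).2))
  decreasing_by
  all_goals first
    | exact Nat.lt_succ_self n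
    | exact Nat.lt_succ_of_lt (Finset.mem_range.mp k.2)
    | exact Finset.mem_range.mp k.2

noncomputable def polyA (n : ℕ) : Polynomial ℂ := (AC n).1
noncomputable def polyC (n : ℕ) : Polynomial ℂ := (AC n).2

lemma polyC_zero : polyC 0 = 0 := by
  simp [polyC, AC]

lemma polyC_succ (n : ℕ) : polyC (n+1) = ((n+1 : ℂ)/(n+2)) •
    ((Polynomial.X^2 + 1) * Polynomial.X^n +
        ∑ k ∈ Finset.range (n+1), ((polyC n).coeff k) • polyC k) := by
  rw [polyC, AC]
  simp only [polyC]
  congr 2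
  exact Finset.sum_attach (Finset.range (n+1)) (fun k => ((AC n).2.coeff k) • (AC k).2)

lemma polyC_deg (n : ℕ) : (polyC n).natDegree ≤ n + 1 := by
  induction n using Nat.strong_induction_on with
  | _ n ih =>
    cases n with
    | zero => simp [polyC_zero]
    | succ n =>
      rw [polyC_succ]
      refine (natDegree_smul_le _ _).trans ?_
      refine natDegree_add_le_of_degree_le ?_ ?_
      · have h : ((Polynomial.X^2 + 1 : Polynomial ℂ) * Polynomial.X^n) = X^(n+2) + X^n := by ring
        rw [h]
        exact natDegree_add_le_of_degree_le (by simp) (by simp; omega)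
      · refine natDegree_sum_le_of_forall_le _ _ ?_
        intro k hk
        have hk' := Finset.mem_range.mp hk
        exact (natDegree_smul_le _ _).trans ((ih k hk').trans (by omega))

lemma polyC_lead (n : ℕ) : (polyC n).coeff (n+1) = (n : ℂ) / (n+1) := by
  cases n with
  | zero => simp [polyC_zero]
  | succ n =>
    rw [polyC_succ]
    have h : ((Polynomial.X^2 + 1 : Polynomial ℂ) * Polynomial.X^n) = X^(n+2) + X^n := by ring
    have h2 : ∑ k ∈ Finset.range (n+1), (((polyC n).coeff k) • polyC k).coeff (n+1+1) = 0 := by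
      refine Finset.sum_eq_zero fun k hk => ?_
      have hk' := Finset.mem_range.mp hk
      rw [coeff_smul, coeff_eq_zero_of_natDegree_lt (p := polyC k), smul_zero]
      have := polyC_deg k
      omega
    rw [h, coeff_smul, coeff_add, finsetSum_coeff, h2]
    simp [coeff_X_pow]
    rw [if_neg (by omega)]; ring

lemma polyC_sum (n : ℕ) (x : ℂ) : (polyC n).eval x =
    ∑ k ∈ Finset.range (n+1), (polyC n).coeff k * x^k + (n : ℂ) / (n+1) * x^(n+1) := by
  rw [eval_eq_sum_range' (n := n+2) (by have := polyC_deg n; omega), Finset.sum_range_succ,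
    polyC_lead]

lemma polyC_diff (n : ℕ) (x : ℂ) : (polyC n).eval (x + 2 * Complex.I) - (polyC n).eval x =
    (x + Complex.I) * ((x + 2 * Complex.I)^n - x^n) := by
  induction n using Nat.strong_induction_on with
  | _ n ih =>
    cases n with
    | zero => simp [polyC_zero]
    | succ n =>
      have h1 : ∀ y : ℂ, (polyC (n+1)).eval y = ((n+1 : ℂ)/(n+2)) * ((y^2+1) * y^n +
          ∑ k ∈ Finset.range (n+1), ((polyC n).coeff k) * (polyC k).eval y) := by
        intro y
        rw [polyC_succ]
        simp [eval_finsetSum]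
        ring
      have h2 : ∑ k ∈ Finset.range (n+1), ((polyC n).coeff k) * (polyC k).eval (x + 2 * Complex.I)
          - ∑ k ∈ Finset.range (n+1), ((polyC n).coeff k) * (polyC k).eval x
          = (x + Complex.I) * (∑ k ∈ Finset.range (n+1), (polyC n).coeff k * (x + 2 * Complex.I)^k
            - ∑ k ∈ Finset.range (n+1), (polyC n).coeff k * x^k) := by
        rw [← Finset.sum_sub_distrib, ← Finset.sum_sub_distrib, Finset.mul_sum]
        refine Finset.sum_congr rfl fun k hk => ?_
        have hk' := Finset.mem_range.mp hk
        rw [← mul_sub, ih k hk']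
        ring
      have h3 := ih n (Nat.lt_succ_self n)
      rw [polyC_sum, polyC_sum n x] at h3
      rw [h1, h1]
      have hn1 : (n + 1 : ℂ) ≠ 0 := by exact_mod_cast Nat.succ_ne_zero n
      have hn2 : (n + 2 : ℂ) ≠ 0 := by exact_mod_cast Nat.succ_ne_zero (n+1)
      have hI : Complex.I ^ 2 = -1 := Complex.I_sq
      generalize (∑ k ∈ Finset.range (n+1), ((polyC n).coeff k) * (polyC k).eval (x + 2 * Complex.I)) = S1 at *
      generalize (∑ k ∈ Finset.range (n+1), ((polyC n).coeff k) * (polyC k).eval x) = S2 at *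
      generalize (∑ k ∈ Finset.range (n+1), (polyC n).coeff k * (x + 2 * Complex.I)^k) = S3 at *
      generalize (∑ k ∈ Finset.range (n+1), (polyC n).coeff k * x^k) = S4 at *
      rw [pow_succ _ n, pow_succ x n] at h3
      rw [pow_succ _ n, pow_succ x n]
      have hS : S1 = S2 + (x + Complex.I) * (S3 - S4) := by linear_combination h2
      have hS3 : S3 = S4 + ((x + Complex.I) * ((x + 2 * Complex.I)^n - x^n)
          - (n:ℂ) / (n+1) * ((x + 2 * Complex.I)^n * (x + 2 * Complex.I) - x^n * x)) := by
        linear_combination h3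
      rw [hS, hS3]
      generalize (x + 2 * Complex.I)^n = p
      generalize x^n = q
      field_simp
      linear_combination (n*p - n*q + p - q)*hI

lemma polyC_I (n : ℕ) : (polyC n).eval Complex.I = 0 := by
  induction n using Nat.strong_induction_on with
  | _ n ih =>
    cases n with
    | zero => simp [polyC_zero]
    | succ n =>
      rw [polyC_succ]
      simp only [eval_smul, eval_add, eval_mul, eval_pow, eval_X, eval_one, eval_finsetSum]
      rw [Finset.sum_eq_zero]
      · simp
      · intro k hk
        rw [ih k (Finset.mem_range.mp hk)]; simp

/-- Bernoulli polynomials over the complex numbers. -/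
noncomputable def bernC (m : ℕ) : Polynomial ℂ := (Polynomial.bernoulli m).map (algebraMap ℚ ℂ)

lemma bernC_add_one (n : ℕ) (y : ℂ) :
    (bernC (n+1)).eval (1 + y) = (bernC (n+1)).eval y + (n+1) * y^n := by
  have h := congr_arg (fun p => (p.map (algebraMap ℚ ℂ)).eval y)
    (Polynomial.bernoulli_comp_one_add_X (n+1))
  simpa [bernC, Polynomial.map_comp, eval_comp] using h

lemma polyC_closed (n : ℕ) (x : ℂ) : (polyC n).eval x =
    (x - Complex.I) * x^n + (2 * Complex.I)^(n+1) / (n+1) *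
      ((bernC (n+1)).eval (1/2) - (bernC (n+1)).eval (x / (2 * Complex.I))) := by
  have hn1 : (n + 1 : ℂ) ≠ 0 := by exact_mod_cast Nat.succ_ne_zero n
  have hI2 : (2 * Complex.I) ≠ 0 := by simp
  let Q : Polynomial ℂ := polyC n - ((X - C Complex.I) * X^n + C ((2 * Complex.I)^(n+1) / (n+1)) *
      (C ((bernC (n+1)).eval (1/2)) - (bernC (n+1)).comp (C (1 / (2 * Complex.I)) * X)))
  have hQe : ∀ y, Q.eval y = (polyC n).eval y - ((y - Complex.I) * y^n +
      (2 * Complex.I)^(n+1) / (n+1) *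
      ((bernC (n+1)).eval (1/2) - (bernC (n+1)).eval (y / (2 * Complex.I)))) := by
    intro y
    simp only [Q, eval_sub, eval_add, eval_mul, eval_comp, eval_C, eval_X, eval_pow]
    rw [one_div_mul_eq_div]
  have hstep : ∀ y, Q.eval (y + 2 * Complex.I) = Q.eval y := by
    intro y
    rw [hQe, hQe]
    have e1 : (y + 2 * Complex.I) / (2 * Complex.I) = 1 + y / (2 * Complex.I) := by
      field_simp; ring
    rw [e1, bernC_add_one]
    have e2 : (2 * Complex.I)^(n+1) / (n+1) * ((n+1) * (y / (2 * Complex.I))^n)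
        = 2 * Complex.I * y^n := by
      rw [div_pow, pow_succ]
      field_simp
    linear_combination polyC_diff n y + e2
  have h0 : ∀ m : ℕ, Q.eval (Complex.I + m * (2 * Complex.I)) = 0 := by
    intro m
    induction m with
    | zero =>
      rw [hQe]
      have : Complex.I / (2 * Complex.I) = 1/2 := by
        have := Complex.I_ne_zero
        field_simp
      simp [polyC_I, this]
    | succ m ih =>
      rw [← ih, ← hstep (Complex.I + m * (2 * Complex.I))]
      congr 1
      push_cast; ring
  have hQ0 : Q = 0 := by
    refine Polynomial.eq_zero_of_infinite_isRoot Q ?_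
    refine Set.Infinite.mono (s := Set.range fun m : ℕ => Complex.I + m * (2 * Complex.I)) ?_ ?_
    · rintro _ ⟨m, rfl⟩; exact h0 m
    · refine Set.infinite_range_of_injective ?_
      intro a b hab
      have h := mul_right_cancel₀ hI2 (add_left_cancel hab)
      exact_mod_cast h
  have := hQe x
  rw [hQ0, eval_zero] at this
  linear_combination -this

open MeasureTheory in
lemma int_pow_exp (j : ℕ) {c : ℝ} (hc : 0 < c) :
    IntegrableOn (fun v : ℝ => v^j * Real.exp (-(c * v))) (Set.Ioi 0) ∧
    ∫ v in Set.Ioi (0:ℝ), v^j * Real.exp (-(c * v)) = (Nat.factorial j : ℝ) / c^(j+1) := by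
  have hk : (0:ℝ) < (j:ℝ) + 1 := by positivity
  have key := Real.integral_rpow_mul_exp_neg_mul_Ioi hk hc
  simp only [add_sub_cancel_right, Real.rpow_natCast] at key
  have h : (1 / c) ^ ((j:ℝ)+1) * Real.Gamma ((j:ℝ)+1) = (Nat.factorial j : ℝ) / c^(j+1) := by
    rw [Real.Gamma_nat_eq_factorial]
    have : ((j:ℝ)+1) = ((j+1 : ℕ) : ℝ) := by push_cast; ring
    rw [this, Real.rpow_natCast, one_div, inv_pow]
    field_simp
  rw [h] at key
  refine ⟨?_, key⟩
  refine Integrable.of_integral_ne_zero ?_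
  rw [key]; positivity

lemma exp_sub_one_ge {v : ℝ} (hv : 0 < v) : v * Real.exp (v/2) ≤ Real.exp v - 1 := by
  have h1 : v/2 ≤ Real.sinh (v/2) := Real.self_le_sinh_iff.mpr (by linarith)
  rw [Real.sinh_eq] at h1
  have h2 : Real.exp v = Real.exp (v/2) * Real.exp (v/2) := by rw [← Real.exp_add]; ring_nf
  have h3 : Real.exp (v/2) * Real.exp (-(v/2)) = 1 := by rw [← Real.exp_add]; simp
  have h4 := Real.exp_pos (v/2)
  nlinarith

open MeasureTheory in
lemma int_J_one (j : ℕ) :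
    IntegrableOn (fun v : ℝ => v^(j+1) / (Real.exp v - 1)) (Set.Ioi 0) := by
  refine Integrable.mono' (int_pow_exp j (c := 1/2) (by norm_num)).1 ?_ ?_
  · exact Measurable.aestronglyMeasurable (by fun_prop)
  · refine (ae_restrict_mem measurableSet_Ioi).mono fun v hv => ?_
    have hv : 0 < v := hv
    have h1 := exp_sub_one_ge hv
    have h4 := Real.exp_pos (v/2)
    have h5 : 0 < v * Real.exp (v/2) := by positivity
    rw [Real.norm_of_nonneg (by apply div_nonneg (by positivity); linarith)]
    have h3 : Real.exp (v/2) * Real.exp (-(1/2*v)) = 1 := by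
      rw [← Real.exp_add]; ring_nf; simp
    calc v^(j+1) / (Real.exp v - 1) ≤ v^(j+1) / (v * Real.exp (v/2)) := by gcongr
      _ = v^j * Real.exp (-(1/2*v)) := by
        rw [div_eq_iff h5.ne']
        linear_combination (-v^(j+1)) * h3

open MeasureTheory in
lemma int_J_neg (j : ℕ) :
    IntegrableOn (fun v : ℝ => v^j / (Real.exp v + 1)) (Set.Ioi 0) := by
  refine Integrable.mono' (int_pow_exp j (c := 1) (by norm_num)).1 ?_ ?_
  · exact Measurable.aestronglyMeasurable (by fun_prop)
  · refine (ae_restrict_mem measurableSet_Ioi).mono fun v hv => ?_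
    have hv : 0 < v := hv
    have h4 := Real.exp_pos v
    rw [Real.norm_of_nonneg (by positivity)]
    calc v^j / (Real.exp v + 1) ≤ v^j / (Real.exp v) := by gcongr; linarith
      _ = v^j * Real.exp (-(1*v)) := by rw [one_mul, Real.exp_neg]; rfl

open MeasureTheory in
lemma hasSum_J (j : ℕ) {s : ℝ} (hs : s = 1 ∨ s = -1) :
    HasSum (fun m : ℕ => s^m * ((Nat.factorial (j+1) : ℝ) / ((m:ℝ)+1)^(j+2)))
      (∫ v in Set.Ioi (0:ℝ), v^(j+1) / (Real.exp v - s)) := by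
  have habs : |s| = 1 := by rcases hs with h | h <;> simp [h]
  have hb := fun m : ℕ => int_pow_exp (j+1) (c := (m:ℝ)+1) (by positivity)
  have hn : ∀ m : ℕ, ∫ v in Set.Ioi (0:ℝ), ‖s^m * (v^(j+1) * Real.exp (-(((m:ℝ)+1) * v)))‖
      = (Nat.factorial (j+1) : ℝ) / ((m:ℝ)+1)^(j+2) := by
    intro m
    rw [← (hb m).2]
    refine setIntegral_congr_fun measurableSet_Ioi fun v hv => ?_
    have hv : 0 < v := hv
    simp only [norm_mul, norm_pow, Real.norm_eq_abs, habs, one_pow, one_mul, Real.abs_exp,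
      abs_of_pos hv]
  have key := hasSum_integral_of_summable_integral_norm
    (μ := volume.restrict (Set.Ioi (0:ℝ)))
    (F := fun (m : ℕ) (v : ℝ) => s^m * (v^(j+1) * Real.exp (-(((m:ℝ)+1) * v))))
    (fun m => (hb m).1.const_mul _) (by
      simp_rw [hn, div_eq_mul_inv]
      refine Summable.mul_left _ ?_
      have h := (summable_nat_add_iff 1).mpr (Real.summable_nat_pow_inv.mpr (show 1 < j + 2 by omega))
      simpa using h)
  have e1 : ∀ m : ℕ, ∫ v in Set.Ioi (0:ℝ), s^m * (v^(j+1) * Real.exp (-(((m:ℝ)+1) * v)))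
      = s^m * ((Nat.factorial (j+1) : ℝ) / ((m:ℝ)+1)^(j+2)) := by
    intro m
    rw [integral_const_mul, (hb m).2]
  simp_rw [e1] at key
  suffices hfin : ∫ v in Set.Ioi (0:ℝ), v^(j+1) / (Real.exp v - s) =
      ∫ v in Set.Ioi (0:ℝ), ∑' m : ℕ, s^m * (v^(j+1) * Real.exp (-(((m:ℝ)+1) * v))) by
    rw [hfin]; exact key
  refine setIntegral_congr_fun measurableSet_Ioi fun v hv => ?_
  have hv : 0 < v := hv
  have hE : Real.exp (-v) < 1 := by rw [Real.exp_lt_one_iff]; linarith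
  have hE0 := Real.exp_pos (-v)
  have hg := (hasSum_geometric_of_norm_lt_one (ξ := s * Real.exp (-v))
    (by rw [norm_mul, Real.norm_eq_abs, habs, Real.norm_eq_abs, Real.abs_exp, one_mul]; exact hE))
  have hg2 := (hg.mul_left (v^(j+1) * Real.exp (-v))).tsum_eq
  have e2 : ∀ m : ℕ, s^m * (v^(j+1) * Real.exp (-(((m:ℝ)+1) * v)))
      = v^(j+1) * Real.exp (-v) * (s * Real.exp (-v))^m := by
    intro m
    rw [mul_pow, ← Real.exp_nat_mul]
    have : Real.exp (-(((m:ℝ)+1) * v)) = Real.exp (-v) * Real.exp (m * -v) := by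
      rw [← Real.exp_add]; ring_nf
    rw [this]; ring
  simp only [e2]
  rw [hg2, Real.exp_neg]
  have hE1 : 1 < Real.exp v := Real.one_lt_exp_iff.mpr hv
  have : Real.exp v - s ≠ 0 := by rcases hs with h | h <;> rw [h] <;> linarith
  have h0 := Real.exp_pos v
  have h1 : 1 - s * (Real.exp v)⁻¹ = (Real.exp v - s) / Real.exp v := by field_simp
  rw [h1]
  field_simp

open Complex in
lemma J_val (j : ℕ) {s θ : ℝ} (hs : (s = 1 ∧ θ = 0) ∨ (s = -1 ∧ θ = 1/2)) :
    (1 - (-1:ℂ)^(j+1)) * ((∫ v in Set.Ioi (0:ℝ), v^(j+1) / (Real.exp v - s) : ℝ) : ℂ) =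
      -(s * ((2 * Real.pi * I)^(j+2) / (j+2) * bernoulliFun (j+2) θ)) := by
  have hs' : s = 1 ∨ s = -1 := by rcases hs with h | h <;> simp [h.1]
  have hθ : θ ∈ Set.Icc (0:ℝ) 1 := by rcases hs with h | h <;> rw [h.2] <;> norm_num
  have hss : (s:ℂ) * s = 1 := by rcases hs' with h | h <;> rw [h] <;> norm_num
  have h1 := hasSum_one_div_nat_pow_mul_fourier (k := j+2) (by omega) hθ
  have hf1 : ∀ n : ℕ, (fourier (n:ℤ) (θ : UnitAddCircle) : ℂ) = (s:ℂ)^n := by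
    intro n
    rw [fourier_coe_apply]
    rcases hs with ⟨h, h'⟩ | ⟨h, h'⟩
    · rw [h, h']; simp
    · rw [h, h']
      have : 2 * (Real.pi:ℂ) * I * ((n:ℤ):ℂ) * ((1/2:ℝ):ℂ) / ((1:ℝ):ℂ) = n * (Real.pi * I) := by
        push_cast; ring
      rw [this, Complex.exp_nat_mul, Complex.exp_pi_mul_I]; simp
  have hf2 : ∀ n : ℕ, (fourier (-(n:ℤ)) (θ : UnitAddCircle) : ℂ) = (s:ℂ)^n := by
    intro n
    rw [fourier_neg, hf1]
    simp
  simp_rw [hf1, hf2] at h1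
  rw [← hasSum_nat_add_iff' 1] at h1
  simp only [Finset.sum_range_one] at h1
  have h2 := ((Complex.hasSum_ofReal.mpr (hasSum_J j hs')).mul_left
    ((1 - (-1:ℂ)^(j+1)) * s / (Nat.factorial (j+1) : ℂ)))
  have hfac : (Nat.factorial (j+1) : ℂ) ≠ 0 := by exact_mod_cast Nat.factorial_ne_zero _
  have e3 : (fun m : ℕ => (1 - (-1:ℂ)^(j+1)) * s / (Nat.factorial (j+1) : ℂ) *
      ((s^m * ((Nat.factorial (j+1) : ℝ) / ((m:ℝ)+1)^(j+2)) : ℝ) : ℂ)) =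
      fun m : ℕ => 1 / ((m + 1 : ℕ) : ℂ)^(j+2) *
        ((s:ℂ)^(m+1) + (-1)^(j+2) * (s:ℂ)^(m+1)) := by
    ext m
    push_cast
    have : ((m:ℂ)+1) ≠ 0 := by exact_mod_cast Nat.succ_ne_zero m
    field_simp
    ring
  rw [e3] at h2
  have h3 := h1.unique h2
  have hfac2 : (Nat.factorial (j+2) : ℂ) = (j+2) * Nat.factorial (j+1) := by
    rw [Nat.factorial_succ]; push_cast; ring
  have hj2 : (j+2:ℂ) ≠ 0 := by exact_mod_cast Nat.succ_ne_zero (j+1)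
  rw [hfac2] at h3
  simp only [Nat.cast_zero, zero_pow (Nat.succ_ne_zero (j+1)), div_zero, zero_mul, sub_zero] at h3
  generalize ((∫ v in Set.Ioi (0:ℝ), v^(j+1) / (Real.exp v - s) : ℝ) : ℂ) = J at *
  field_simp at h3 ⊢
  linear_combination (-(j+2:ℂ) * J * (1 - (-1:ℂ)^(j+1))) * hss - s * h3

open MeasureTheory in
lemma fold_integral {f : ℝ → ℝ} (hp : IntegrableOn f (Set.Ioi 0))
    (hm : IntegrableOn (fun v => f (-v)) (Set.Ioi 0)) :
    Integrable f ∧ ∫ v, f v = (∫ v in Set.Ioi 0, f v) + ∫ v in Set.Ioi 0, f (-v) := by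
  have h1 : IntegrableOn f (Set.Iic 0) := by
    have hm' : IntegrableOn (fun v => f (-v)) (Set.Ioi (-(0:ℝ))) := by rw [neg_zero]; exact hm
    have h := hm'.comp_neg_Iio
    simp only [neg_neg] at h
    exact (integrableOn_Iic_iff_integrableOn_Iio).mpr h
  have hI : Integrable f := by
    rw [← integrableOn_univ, ← Set.Iic_union_Ioi (a := (0:ℝ))]
    exact h1.union hp
  refine ⟨hI, ?_⟩
  rw [integral_comp_neg_Ioi, neg_zero, ← intervalIntegral.integral_Iic_add_Ioi h1 hp]
  ring

open MeasureTheory in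
lemma part_A (n : ℕ) (z : ℝ) :
    Integrable (fun v : ℝ => ((z + v)^n - z^n) *
      (1 / (1 - Real.exp (-v)) - if 0 < v then 1 else 0)) ∧
    ∫ v : ℝ, ((z + v)^n - z^n) * (1 / (1 - Real.exp (-v)) - if 0 < v then 1 else 0) =
      ∑ j ∈ Finset.range n, (n.choose (j+1) * z^(n-(j+1))) *
        ((1 - (-1)^(j+1)) * ∫ v in Set.Ioi (0:ℝ), v^(j+1) / (Real.exp v - 1)) := by
  set f : ℝ → ℝ := fun v : ℝ => ((z + v)^n - z^n) *
      (1 / (1 - Real.exp (-v)) - if 0 < v then 1 else 0) with hf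
  have hexp : ∀ v : ℝ, (z + v)^n - z^n =
      ∑ j ∈ Finset.range n, (n.choose (j+1) * z^(n-(j+1))) * v^(j+1) := by
    intro v
    rw [add_comm z v, add_pow, Finset.sum_range_succ']
    simp only [pow_zero, Nat.sub_zero, Nat.choose_zero_right, Nat.cast_one, mul_one, one_mul,
      add_sub_cancel_right]
    exact Finset.sum_congr rfl fun j _ => by ring
  have h1 : Set.EqOn (fun v => ∑ j ∈ Finset.range n, (n.choose (j+1) * z^(n-(j+1))) *
      (v^(j+1) / (Real.exp v - 1))) f (Set.Ioi 0) := by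
    intro v hv
    have hv : 0 < v := hv
    have hE1 : 1 < Real.exp v := Real.one_lt_exp_iff.mpr hv
    have hE2 : Real.exp v - 1 ≠ 0 := by linarith
    have e : 1 / (1 - Real.exp (-v)) - 1 = 1 / (Real.exp v - 1) := by
      rw [Real.exp_neg]
      have : 1 - (Real.exp v)⁻¹ = (Real.exp v - 1) / Real.exp v := by field_simp
      rw [this]
      field_simp
      ring
    simp only [hf, if_pos hv]
    rw [e, hexp, Finset.sum_mul]
    exact Finset.sum_congr rfl fun j _ => by ring
  have h2 : Set.EqOn (fun v => ∑ j ∈ Finset.range n, (-(-1)^(j+1) *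
      (n.choose (j+1) * z^(n-(j+1)))) *
      (v^(j+1) / (Real.exp v - 1))) (fun v => f (-v)) (Set.Ioi 0) := by
    intro v hv
    have hv : 0 < v := hv
    have hE1 : 1 < Real.exp v := Real.one_lt_exp_iff.mpr hv
    have hE2 : Real.exp v - 1 ≠ 0 := by linarith
    have e : 1 / (1 - Real.exp v) = -(1 / (Real.exp v - 1)) := by
      rw [← neg_sub (Real.exp v) 1, one_div_neg_eq_neg_one_div]
    simp only [hf, if_neg (show ¬ 0 < -v by linarith), neg_neg, sub_zero]
    rw [e, hexp, Finset.sum_mul]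
    exact Finset.sum_congr rfl fun j _ => by rw [neg_pow v]; ring
  have i1 : ∀ c : ℕ → ℝ, ∀ j ∈ Finset.range n,
      Integrable (fun v : ℝ => c j * (v^(j+1) / (Real.exp v - 1)))
        (volume.restrict (Set.Ioi 0)) := fun c j _ => (int_J_one j).const_mul _
  have I1 := IntegrableOn.congr_fun (integrable_finsetSum (Finset.range n)
    (i1 fun j => n.choose (j+1) * z^(n-(j+1)))) h1 measurableSet_Ioi
  have I2 := IntegrableOn.congr_fun (integrable_finsetSum (Finset.range n)
    (i1 fun j => -(-1)^(j+1) * (n.choose (j+1) * z^(n-(j+1))))) h2 measurableSet_Ioi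
  obtain ⟨hI, hv⟩ := fold_integral I1 I2
  refine ⟨hI, ?_⟩
  rw [hv, ← setIntegral_congr_fun measurableSet_Ioi h1,
    ← setIntegral_congr_fun measurableSet_Ioi h2,
    integral_finsetSum _ (i1 fun j => n.choose (j+1) * z^(n-(j+1))),
    integral_finsetSum _ (i1 fun j => -(-1)^(j+1) * (n.choose (j+1) * z^(n-(j+1)))),
    ← Finset.sum_add_distrib]
  refine Finset.sum_congr rfl fun j _ => ?_
  rw [integral_const_mul, integral_const_mul]
  ring

open MeasureTheory in
lemma part_B (n : ℕ) (z : ℝ) :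
    Integrable (fun v : ℝ => (v^n - z^n) *
      (1 / (1 + Real.exp (-v)) - if 0 < v then 1 else 0)) ∧
    ∫ v : ℝ, (v^n - z^n) * (1 / (1 + Real.exp (-v)) - if 0 < v then 1 else 0) =
        -((1 - (-1)^n) * ∫ v in Set.Ioi (0:ℝ), v^n / (Real.exp v + 1)) := by
  set f : ℝ → ℝ := fun v : ℝ => (v^n - z^n) *
      (1 / (1 + Real.exp (-v)) - if 0 < v then 1 else 0) with hf
  have h1 : Set.EqOn (fun v => z^n * (v^0 / (Real.exp v + 1)) - (v^n / (Real.exp v + 1)))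
      f (Set.Ioi 0) := by
    intro v hv
    have hv : 0 < v := hv
    have hE := Real.exp_pos v
    simp only [hf, if_pos hv]
    rw [Real.exp_neg]
    field_simp
    ring
  have h2 : Set.EqOn (fun v => (-1)^n * (v^n / (Real.exp v + 1)) - z^n * (v^0 / (Real.exp v + 1)))
      (fun v => f (-v)) (Set.Ioi 0) := by
    intro v hv
    have hv : 0 < v := hv
    have hE := Real.exp_pos v
    simp only [hf, if_neg (show ¬ 0 < -v by linarith), neg_neg, sub_zero]
    rw [neg_pow v]
    field_simp
    ring
  have J0 := (int_J_neg 0).const_mul (z^n)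
  have Jn := int_J_neg n
  obtain ⟨hI, hv⟩ := fold_integral (IntegrableOn.congr_fun (J0.sub Jn) h1 measurableSet_Ioi)
    (IntegrableOn.congr_fun ((Jn.const_mul ((-1)^n)).sub J0) h2 measurableSet_Ioi)
  refine ⟨hI, ?_⟩
  rw [hv, ← setIntegral_congr_fun measurableSet_Ioi h1,
    ← setIntegral_congr_fun measurableSet_Ioi h2, integral_sub J0 Jn,
    integral_sub (Jn.const_mul _) J0, integral_const_mul, integral_const_mul]
  ring

open MeasureTheory in
lemma part_C (n : ℕ) (z : ℝ) :
    Integrable (fun u : ℝ => (u^n - z^n) *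
      ((if z < u then 1 else 0) - if 0 < u then 1 else 0)) ∧
    ∫ u : ℝ, (u^n - z^n) * ((if z < u then 1 else 0) - if 0 < u then 1 else 0) =
        (n:ℝ) / (n+1) * z^(n+1) := by
  have e : (fun u : ℝ => (u^n - z^n) *
      ((if z < u then 1 else 0) - if 0 < u then 1 else 0)) =
      fun u => (Set.Ioc z 0).indicator (fun u : ℝ => u^n - z^n) u -
        (Set.Ioc 0 z).indicator (fun u : ℝ => u^n - z^n) u := by
    ext u
    simp only [Set.indicator, Set.mem_Ioc]
    rcases lt_or_ge z u with h1 | h1 <;> rcases lt_or_ge 0 u with h2 | h2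
    · simp [h1, h2, not_le.mpr h1, not_le.mpr h2]
    · simp [h1, h2, not_le.mpr h1, not_lt.mpr h2]
    · simp [h1, h2, not_lt.mpr h1, not_le.mpr h2]
    · simp [h1, h2, not_lt.mpr h1, not_lt.mpr h2]
  have hc : Continuous fun u : ℝ => u^n - z^n := by fun_prop
  have i1 : ∀ a b : ℝ, Integrable ((Set.Ioc a b).indicator (fun u : ℝ => u^n - z^n)) := by
    intro a b
    rw [integrable_indicator_iff measurableSet_Ioc]
    exact (hc.integrableOn_Icc (a := a) (b := b)).mono_set Set.Ioc_subset_Icc_self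
  rw [e]
  refine ⟨(i1 _ _).sub (i1 _ _), ?_⟩
  rw [integral_sub (i1 _ _) (i1 _ _), integral_indicator measurableSet_Ioc,
    integral_indicator measurableSet_Ioc]
  change (∫ u in z..0, (u^n - z^n)) = _
  rw [intervalIntegral.integral_sub (by simp) (by simp), integral_pow,
    intervalIntegral.integral_const]
  have : (n + 1 : ℝ) ≠ 0 := by positivity
  simp
  field_simp
  ring

open MeasureTheory in
lemma main_real (n : ℕ) (z : ℝ) :
    (Real.exp z + 1) *
        ∫ t in Set.Ioi (0 : ℝ),
          ((Real.log t) ^ n - z ^ n) / ((1 + t) * (t - Real.exp z)) =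
      ∑ j ∈ Finset.range n, (n.choose (j+1) * z^(n-(j+1))) *
        ((1 - (-1)^(j+1)) * ∫ v in Set.Ioi (0:ℝ), v^(j+1) / (Real.exp v - 1)) +
      (1 - (-1)^n) * (∫ v in Set.Ioi (0:ℝ), v^n / (Real.exp v + 1)) +
      (n:ℝ) / (n+1) * z^(n+1) := by
  have himg : Real.exp '' Set.univ = Set.Ioi 0 := by rw [Set.image_univ, Real.range_exp]
  rw [← himg, integral_image_eq_integral_abs_deriv_smul MeasurableSet.univ
    (fun x _ => (Real.hasDerivAt_exp x).hasDerivWithinAt) Real.exp_injective.injOn,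
    setIntegral_univ, ← integral_const_mul]
  obtain ⟨iA, vA⟩ := part_A n z
  obtain ⟨iB, vB⟩ := part_B n z
  obtain ⟨iC, vC⟩ := part_C n z
  have iA' := iA.comp_sub_right z
  have sA := integral_sub_right_eq_self (μ := volume) (fun v : ℝ => ((z + v)^n - z^n) *
      (1 / (1 - Real.exp (-v)) - if 0 < v then 1 else 0)) z
  rw [himg, ← vA, ← sA, ← vC, ← neg_neg ((1 - (-1)^n) * _), ← vB,
    ← sub_eq_add_neg, ← integral_sub iA' iB]
  refine Eq.trans ?_ (integral_add (iA'.sub iB) iC)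
  congr 1
  ext u
  simp only [Pi.sub_apply, Real.log_exp, Real.abs_exp, smul_eq_mul, sub_pos, add_sub_cancel]
  by_cases huz : u = z
  · simp [huz]
  have hk : (Real.exp z + 1) * Real.exp u / ((1 + Real.exp u) * (Real.exp u - Real.exp z)) =
      1 / (1 - Real.exp (-(u - z))) - 1 / (1 + Real.exp (-u)) := by
    have h1 := Real.exp_pos u
    have h2 := Real.exp_pos z
    have h3 : Real.exp u - Real.exp z ≠ 0 := by
      rw [sub_ne_zero]; exact fun h => huz (Real.exp_injective h)
    have h4 : 1 - Real.exp (-(u - z)) = (Real.exp u - Real.exp z) / Real.exp u := by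
      rw [neg_sub, Real.exp_sub]; field_simp
    have h5 : 1 + Real.exp (-u) = (1 + Real.exp u) / Real.exp u := by
      rw [Real.exp_neg]; field_simp; ring
    rw [h4, h5]
    field_simp
    ring
  linear_combination (u^n - z^n) * hk

lemma bernC_real (m : ℕ) (x : ℝ) : (bernC m).eval (x:ℂ) = (bernoulliFun m x : ℂ) := by
  rw [bernC, bernoulliFun, eval_map, eval_map, ← Complex.coe_algebraMap, hom_eval₂]
  rfl

lemma bernC_expand (n : ℕ) (y : ℂ) : (bernC (n+1)).eval y =
    y^(n+1) - (n+1) / 2 * y^n + ∑ j ∈ Finset.range n,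
      (_root_.bernoulli (j+2) : ℂ) * ((n+1).choose (j+2)) * y^(n-(j+1)) := by
  rw [bernC, Polynomial.bernoulli, Polynomial.map_sum, eval_finsetSum, Finset.sum_range_succ',
    Finset.sum_range_succ']
  simp only [map_monomial, eval_monomial]
  simp only [Nat.add_sub_add_right, add_assoc, Nat.reduceAdd]
  simp
  ring

lemma final_sum (n : ℕ) (z : ℂ) {w : ℂ} (hw : w ≠ 0) :
    w^(n+1) / (n+1) * (bernC (n+1)).eval (z / w) =
      z^(n+1) / (n+1) - w / 2 * z^n +
      ∑ j ∈ Finset.range n, (n.choose (j+1) * z^(n-(j+1))) *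
        (w^(j+2) / (j+2) * (_root_.bernoulli (j+2) : ℂ)) := by
  have hn1 : (n + 1 : ℂ) ≠ 0 := by exact_mod_cast Nat.succ_ne_zero n
  rw [bernC_expand, mul_add, Finset.mul_sum]
  congr 1
  · rw [div_pow, div_pow, pow_succ w]
    field_simp
  · refine Finset.sum_congr rfl fun j hj => ?_
    have hj' := Finset.mem_range.mp hj
    have hj2 : (j + 2 : ℂ) ≠ 0 := by exact_mod_cast Nat.succ_ne_zero (j+1)
    have hch : ((n:ℂ) + 1) * n.choose (j+1) = (n+1).choose (j+2) * (j+2) := by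
      exact_mod_cast Nat.add_one_mul_choose_eq n (j+1)
    have hw2 : w^(n+1) = w^(j+2) * w^(n-(j+1)) := by rw [← pow_add]; congr 1; omega
    rw [div_pow, hw2]
    field_simp
    linear_combination (-(_root_.bernoulli (j+2) : ℂ) * z^(n-(j+1))) * hch

theorem stmt13 (n : ℕ) (z : ℝ) :
    (((Real.exp z + 1) *
        ∫ t in Set.Ioi (0 : ℝ),
          ((Real.log t) ^ n - z ^ n) / ((1 + t) * (t - Real.exp z)) : ℝ) : ℂ) =
      (Real.pi : ℂ) ^ (n + 1) * (polyC n).eval ((z : ℂ) / (Real.pi : ℂ)) := by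
  cases n with
  | zero => simp [polyC_zero]
  | succ n =>
    have hpi : (Real.pi : ℂ) ≠ 0 := by exact_mod_cast Real.pi_ne_zero
    have hw : (2 * Real.pi * Complex.I : ℂ) ≠ 0 := by simp [Real.pi_ne_zero]
    have hfin := final_sum (n+1) z hw
    rw [main_real, polyC_closed]
    have e1 := J_val n (s := -1) (θ := 1/2) (Or.inr ⟨rfl, rfl⟩)
    have e2 := fun j => J_val j (s := 1) (θ := 0) (Or.inl ⟨rfl, rfl⟩)
    simp only [sub_neg_eq_add, bernoulliFun_eval_zero] at e1 e2
    rw [← bernC_real] at e1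
    push_cast at e1 e2 hfin ⊢
    simp_rw [e2]
    rw [e1]
    have e3 : (z:ℂ) / Real.pi / (2 * Complex.I) = z / (2 * Real.pi * Complex.I) := by
      rw [div_div]; congr 1; ring
    have e4 : (2 * Real.pi * Complex.I : ℂ)^(n+1+1) = Real.pi^(n+1+1) * (2 * Complex.I)^(n+1+1) := by
      rw [← mul_pow]; congr 1; ring
    have e5 : (Real.pi : ℂ)^(n+1+1) * ((z / Real.pi - Complex.I) * (z / Real.pi)^(n+1)) =
        z^(n+1+1) - Real.pi * Complex.I * z^(n+1) := by
      rw [div_pow, pow_succ (Real.pi : ℂ) (n+1), pow_succ (z : ℂ) (n+1)]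
      field_simp
    rw [e3, mul_add, e5]
    have e6 : (Real.pi : ℂ)^(n+1+1) * ((2 * Complex.I)^(n+1+1) / (n+1+1) *
        ((bernC (n+1+1)).eval (1/2) - (bernC (n+1+1)).eval (z / (2 * Real.pi * Complex.I)))) =
        (2 * Real.pi * Complex.I : ℂ)^(n+1+1) / (n+1+1) * (bernC (n+1+1)).eval (1/2) -
        (2 * Real.pi * Complex.I : ℂ)^(n+1+1) / (n+1+1) *
          (bernC (n+1+1)).eval (z / (2 * Real.pi * Complex.I)) := by
      rw [e4]; ring
    rw [e6, hfin]
    simp only [one_mul, mul_neg, Finset.sum_neg_distrib]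
    have hn2 : (n + 1 + 1 : ℂ) ≠ 0 := by exact_mod_cast Nat.succ_ne_zero (n+1)
    have hn3 : (n + 2 : ℂ) ≠ 0 := by exact_mod_cast Nat.succ_ne_zero (n+1)
    have e7 : (n + 1 + 1 : ℂ) = n + 2 := by ring
    rw [e7]
    field_simp
    ring
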